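/- arXiv:1511.04580 — 2 statements merged into one kernel-verified Lean document; each statement's English description precedes it below -/
import Mathlib

section
/- Let m, n be positive integers and r a nonnegative integer with m ≤ n and r < m, and set k = m − r. Then N(n, m − r, m; r) = mn − m(m − r − 1) = m(n − m + r + 1). -/
/-- `A` is a combinatorial batch code with redundancy `r` (`t = 1`), in the
Hall-type column characterization. -/
def IsRCBC (r k : ℕ) {n m : ℕ} (A : Fin n → Finset (Fin m)) : Prop :=
  ∀ J : Finset (Fin n), 1 ≤ J.card → J.card ≤ k →
    r + J.card ≤ (J.biUnion A).card

/-- The weight `N(A)` of a family of columns. -/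
def weight {n m : ℕ} (A : Fin n → Finset (Fin m)) : ℕ := ∑ j, (A j).card

/-- `N(n,k,m;r)`: the minimum weight of an `r`-CBC(n,k,m). -/
noncomputable def minWeight (n k m r : ℕ) : ℕ :=
  sInf {w | ∃ A : Fin n → Finset (Fin m), IsRCBC r k A ∧ weight A = w}

/-- The cyclic interval of length `r + 1` starting at `j` in `Fin m`. -/
def cyclicWindow (m r : ℕ) [NeZero m] (j : ℕ) : Finset (Fin m) :=
  (Finset.range (r + 1)).image fun t => Fin.ofNat m (j + t)

lemma card_cyclicWindow_le (m r : ℕ) [NeZero m] (j : ℕ) :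
    (cyclicWindow m r j).card ≤ r + 1 := by
  simpa [cyclicWindow] using
    Finset.card_image_le (s := Finset.range (r + 1)) (f := fun t => Fin.ofNat m (j + t))

lemma mem_cyclicWindow {m r j : ℕ} [NeZero m] {x : Fin m} :
    x ∈ cyclicWindow m r j ↔ ∃ t ≤ r, Fin.ofNat m (j + t) = x := by
  simp [cyclicWindow]

/-- A nonempty subset of `Fin m` closed under cyclic shift is everything. -/
lemma eq_univ_of_forall_shift_mem {m : ℕ} [NeZero m] {S : Finset (Fin m)} (hS : S.Nonempty)
    (h : ∀ x ∈ S, Fin.ofNat m (x + 1) ∈ S) : S = Finset.univ := by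
  obtain ⟨i, hi⟩ := hS
  have hshift : ∀ t : ℕ, Fin.ofNat m (i + t) ∈ S := by
    intro t
    induction t with
    | zero => simpa using hi
    | succ t ih =>
      have := h _ ih
      simpa [Fin.ext_iff, Fin.ofNat, ← add_assoc] using this
  refine Finset.eq_univ_of_forall fun x => ?_
  have hx : Fin.ofNat m (i + (m + x - i)) = x := by
    have : (i : ℕ) + (m + x - i) = m + x := by have := i.isLt; omega
    rw [this]
    simp [Fin.ofNat, Nat.mod_eq_of_lt x.isLt]
  exact hx ▸ hshift _

/-- A Cauchy–Davenport bound for adding an interval to a set in the cyclic group of order `m`. -/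
lemma add_card_le_card_biUnion_cyclicWindow {m : ℕ} [NeZero m] {J : Finset ℕ}
    (hJ : J.Nonempty) (hJm : ∀ j ∈ J, j < m) (r : ℕ) :
    r + J.card ≤ (J.biUnion (cyclicWindow m r)).card ∨
      J.biUnion (cyclicWindow m r) = Finset.univ := by
  induction r with
  | zero =>
    left
    have : J.biUnion (cyclicWindow m 0) = J.image (Fin.ofNat m) := by
      ext x
      simp [mem_cyclicWindow]
    rw [this, Finset.card_image_of_injOn, zero_add]
    intro a ha b hb hab
    simpa [Fin.ext_iff, Fin.ofNat, Nat.mod_eq_of_lt (hJm a ha), Nat.mod_eq_of_lt (hJm b hb)]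
      using hab
  | succ r ih =>
    have hsub : J.biUnion (cyclicWindow m r) ⊆ J.biUnion (cyclicWindow m (r + 1)) := by
      intro x
      simp only [Finset.mem_biUnion, mem_cyclicWindow]
      rintro ⟨j, hj, t, ht, rfl⟩
      exact ⟨j, hj, t, by omega, rfl⟩
    have hshift : ∀ x ∈ J.biUnion (cyclicWindow m r),
        Fin.ofNat m (x + 1) ∈ J.biUnion (cyclicWindow m (r + 1)) := by
      intro x
      simp only [Finset.mem_biUnion, mem_cyclicWindow]
      rintro ⟨j, hj, t, ht, rfl⟩
      exact ⟨j, hj, t + 1, by omega, by simp [Fin.ofNat, ← add_assoc]⟩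
    rcases ih with ih | ih
    · by_cases heq : J.biUnion (cyclicWindow m r) = J.biUnion (cyclicWindow m (r + 1))
      · right
        rw [← heq] at hshift ⊢
        have hpos := hJ.card_pos
        exact eq_univ_of_forall_shift_mem (Finset.card_pos.mp (by omega)) hshift
      · left
        have := Finset.card_lt_card (hsub.ssubset_of_ne heq)
        omega
    · right
      exact Finset.univ_subset_iff.mp (ih ▸ hsub)

/-- A code of maximal `k = m - r`: the first `m` columns are cyclic intervals of length `r + 1`,
the remaining ones are full. -/
def cyclicCode (n m r : ℕ) [NeZero m] (j : Fin n) : Finset (Fin m) :=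
  if (j : ℕ) < m then cyclicWindow m r j else Finset.univ

lemma isRCBC_cyclicCode {n m r : ℕ} [NeZero m] (hrm : r < m) :
    IsRCBC r (m - r) (cyclicCode n m r) := by
  intro J hJ hJk
  have huniv : J.biUnion (cyclicCode n m r) = Finset.univ →
      r + J.card ≤ (J.biUnion (cyclicCode n m r)).card := by
    intro h
    rw [h, Finset.card_univ, Fintype.card_fin]
    omega
  by_cases hlt : ∀ j ∈ J, (j : ℕ) < m
  · have heq : J.biUnion (cyclicCode n m r) =
        (J.map Fin.valEmbedding).biUnion (cyclicWindow m r) := by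
      ext x
      simp only [Finset.mem_biUnion, Finset.mem_map, Fin.valEmbedding_apply,
        exists_exists_and_eq_and]
      refine exists_congr fun j => and_congr_right fun hj => ?_
      rw [cyclicCode, if_pos (hlt j hj)]
    rcases add_card_le_card_biUnion_cyclicWindow (m := m) (J := J.map Fin.valEmbedding)
      (by simpa using Finset.card_pos.mp hJ) (by simpa using hlt) r with h | h
    · rwa [← heq, Finset.card_map] at h
    · exact huniv (heq.trans h)
  · push Not at hlt
    obtain ⟨j, hj, hjm⟩ := hlt
    refine huniv (Finset.univ_subset_iff.mp ?_)
    have := Finset.subset_biUnion_of_mem (cyclicCode n m r) hj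
    rwa [cyclicCode, if_neg (by omega)] at this

lemma weight_cyclicCode_le {n m r : ℕ} [NeZero m] (hmn : m ≤ n) :
    weight (cyclicCode n m r) ≤ m * (n - m + r + 1) := by
  obtain ⟨d, rfl⟩ := Nat.exists_eq_add_of_le hmn
  calc weight (cyclicCode (m + d) m r)
      ≤ ∑ j : Fin (m + d), if (j : ℕ) < m then r + 1 else m := by
        refine Finset.sum_le_sum fun j _ => ?_
        unfold cyclicCode
        split_ifs
        · exact card_cyclicWindow_le m r j
        · simp
    _ = m * (m + d - m + r + 1) := by
        rw [Fin.sum_univ_add]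
        simp
        ring

/-- In an `r`-CBC with `k = m - r`, fewer than `k` columns avoid any given row. -/
lemma IsRCBC.card_filter_notMem_lt {n m r : ℕ} {A : Fin n → Finset (Fin m)}
    (hA : IsRCBC r (m - r) A) (hrm : r < m) (i : Fin m) :
    (Finset.univ.filter fun j => i ∉ A j).card < m - r := by
  by_contra! h
  obtain ⟨J, hJ, hcard⟩ := Finset.exists_subset_card_eq h
  have hle := hA J (by omega) hcard.le
  have hi : i ∉ J.biUnion A := by
    simp only [Finset.mem_biUnion, not_exists, not_and]
    exact fun j hj => (Finset.mem_filter.mp (hJ hj)).2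
  have hlt := Finset.card_lt_univ_of_notMem hi
  rw [Fintype.card_fin] at hlt
  omega

lemma IsRCBC.le_weight {n m r : ℕ} {A : Fin n → Finset (Fin m)}
    (hA : IsRCBC r (m - r) A) (hmn : m ≤ n) (hrm : r < m) :
    m * (n - m + r + 1) ≤ weight A := by
  have hdouble : weight A = ∑ i, (Finset.univ.filter fun j => i ∈ A j).card := by
    simp only [weight, Finset.card_filter]
    rw [Finset.sum_comm]
    simp
  have hrow : ∀ i ∈ (Finset.univ : Finset (Fin m)),
      n - m + r + 1 ≤ (Finset.univ.filter fun j => i ∈ A j).card := by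
    intro i _
    have hlt := hA.card_filter_notMem_lt hrm i
    have hadd := Finset.card_filter_add_card_filter_not (s := Finset.univ) (fun j => i ∈ A j)
    rw [Finset.card_univ, Fintype.card_fin] at hadd
    omega
  simpa [hdouble] using Finset.card_nsmul_le_sum _ _ _ hrow

/-- Theorem `thm:maxk`: if `m ≤ n` and `k = m - r`, then
`N(n,m-r,m;r) = mn - m(m-r-1) = m(n-m+r+1)`. -/
theorem minWeight_maxk (n m r : ℕ) (hm : 0 < m) (hmn : m ≤ n) (hrm : r < m) :
    minWeight n (m - r) m r = m * n - m * (m - r - 1) ∧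
      minWeight n (m - r) m r = m * (n - m + r + 1) := by
  have : NeZero m := ⟨hm.ne'⟩
  have hmin : minWeight n (m - r) m r = m * (n - m + r + 1) := by
    have hcode : weight (cyclicCode n m r) ∈
        {w | ∃ A : Fin n → Finset (Fin m), IsRCBC r (m - r) A ∧ weight A = w} :=
      ⟨_, isRCBC_cyclicCode hrm, rfl⟩
    refine le_antisymm ((Nat.sInf_le hcode).trans (weight_cyclicCode_le hmn)) ?_
    refine le_csInf ⟨_, hcode⟩ ?_
    rintro w ⟨A, hA, rfl⟩
    exact hA.le_weight hmn hrm
  refine ⟨?_, hmin⟩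
  rw [hmin, ← Nat.mul_sub]
  congr 1
  omega
end

section
/- Let k ≥ 3, r ≥ 0, and m ≥ r + k be integers, and suppose A = (A_1, …, A_n) is an r-CBC(n,k,m) in which every column has cardinality exactly r + k − 2, i.e., |A_j| = r + k − 2 for all j ∈ [n]. Then n·(m − r − k + 2) ≤ (k − 1)·C(m, r + k − 1); equivalently, n·(r + k − 1) ≤ (k − 1)·C(m, r + k − 2). In particular, F(k,m,r) ≤ ((k − 1)/(r + k − 1))·C(m, r + k − 2), where F(k,m,r) is the largest n for which such an r-CBC(n,k,m) exists. -/
/-- `F(k,m,r)`: the largest `n` such that there exists an `r`-CBC(n,k,m)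
all of whose columns have cardinality `r + k - 2`. -/
noncomputable def F (k m r : ℕ) : ℕ :=
  sSup {n | ∃ A : Fin n → Finset (Fin m), IsRCBC r k A ∧
    ∀ j : Fin n, (A j).card = r + k - 2}

/-- A `d`-element set has at least `m - d` supersets of cardinality `d + 1`. -/
theorem card_sub_card_le_card_supersets {m d : ℕ} (B : Finset (Fin m)) (hB : B.card = d) :
    m - d ≤ (((Finset.univ : Finset (Fin m)).powersetCard (d + 1)).filter (B ⊆ ·)).card := by
  have himage : Bᶜ.image (fun x => insert x B) ⊆
      ((Finset.univ : Finset (Fin m)).powersetCard (d + 1)).filter (B ⊆ ·) := by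
    intro S hS
    obtain ⟨x, hx, rfl⟩ := Finset.mem_image.1 hS
    rw [Finset.mem_compl] at hx
    simp [Finset.mem_powersetCard, Finset.card_insert_of_notMem hx, hB]
  refine le_trans (le_of_eq ?_) (Finset.card_le_card himage)
  rw [Finset.card_image_of_injOn, Finset.card_compl, Fintype.card_fin, hB]
  intro x hx y hy hxy
  have hxB : x ∉ B := by simpa using hx
  have hmem : x ∈ insert y B := by
    rw [← show insert x B = insert y B from hxy]
    exact Finset.mem_insert_self x B
  exact (Finset.mem_insert.1 hmem).resolve_right hxB

/-- Fewer than `k` columns of an `r`-CBC are contained in a set of fewer than `r + k` points. -/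
theorem IsRCBC.card_filter_subset_lt {n m k r : ℕ} (hk : 1 ≤ k) {A : Fin n → Finset (Fin m)}
    (hA : IsRCBC r k A) {S : Finset (Fin m)} (hS : S.card < r + k) :
    (Finset.univ.filter (fun j => A j ⊆ S)).card < k := by
  by_contra! h
  obtain ⟨J, hJ, hJcard⟩ := Finset.exists_subset_card_eq h
  have hunion : J.biUnion A ⊆ S :=
    Finset.biUnion_subset.2 fun j hj => (Finset.mem_filter.1 (hJ hj)).2
  have := hA J (by omega) (by omega)
  have := Finset.card_le_card hunion
  omega

/-- Double counting of the pairs consisting of a column and a superset with one more element. -/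
theorem IsRCBC.mul_le_mul_choose_succ {n m k r d : ℕ} (hk : 1 ≤ k) (hd : d + 2 = r + k)
    {A : Fin n → Finset (Fin m)} (hA : IsRCBC r k A) (hcard : ∀ j, (A j).card = d) :
    n * (m - d) ≤ (k - 1) * m.choose (d + 1) := by
  have h := Finset.card_mul_le_card_mul (fun (j : Fin n) S => A j ⊆ S)
    (s := Finset.univ) (t := (Finset.univ : Finset (Fin m)).powersetCard (d + 1))
    (m := m - d) (n := k - 1)
    (fun j _ => card_sub_card_le_card_supersets (A j) (hcard j))
    (fun S hS => by
      have hScard := (Finset.mem_powersetCard.1 hS).2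
      exact Nat.le_sub_one_of_lt (hA.card_filter_subset_lt hk (by omega)))
  rw [Finset.card_powersetCard, Finset.card_fin, Finset.card_fin] at h
  rwa [mul_comm (k - 1)]

theorem IsRCBC.mul_le_mul_choose {n m k r d : ℕ} (hk : 1 ≤ k) (hd : d + 2 = r + k)
    (hdm : d < m) {A : Fin n → Finset (Fin m)} (hA : IsRCBC r k A)
    (hcard : ∀ j, (A j).card = d) :
    n * (d + 1) ≤ (k - 1) * m.choose d := by
  refine Nat.le_of_mul_le_mul_right ?_ (Nat.sub_pos_of_lt hdm)
  calc n * (d + 1) * (m - d) = n * (m - d) * (d + 1) := by ring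
    _ ≤ (k - 1) * m.choose (d + 1) * (d + 1) :=
      Nat.mul_le_mul_right _ (hA.mul_le_mul_choose_succ hk hd hcard)
    _ = (k - 1) * m.choose d * (m - d) := by
      rw [mul_assoc, Nat.choose_succ_right_eq, mul_assoc]

/-- Lemma `lem:fmkr_inequality`: if `A` is an `r`-CBC(n,k,m)
with all columns of cardinality `r+k-2`, then
`n(m-r-k+2) ≤ (k-1)·C(m,r+k-1)`, equivalently `n(r+k-1) ≤ (k-1)·C(m,r+k-2)`;
in particular `F(k,m,r) ≤ (k-1)/(r+k-1)·C(m,r+k-2)`. -/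
theorem fmkr_inequality (n m k r : ℕ) (hk : 3 ≤ k) (hm : r + k ≤ m)
    (A : Fin n → Finset (Fin m)) (hA : IsRCBC r k A)
    (hcard : ∀ j : Fin n, (A j).card = r + k - 2) :
    n * (m - r - k + 2) ≤ (k - 1) * Nat.choose m (r + k - 1) ∧
      n * (r + k - 1) ≤ (k - 1) * Nat.choose m (r + k - 2) ∧
      (F k m r : ℚ) ≤
        ((k : ℚ) - 1) / ((r : ℚ) + k - 1) * Nat.choose m (r + k - 2) := by
  obtain ⟨d, hd⟩ : ∃ d, d + 2 = r + k := ⟨r + k - 2, by omega⟩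
  have hd_eq : r + k - 2 = d := by omega
  have hd_succ : r + k - 1 = d + 1 := by omega
  have hm_sub : m - r - k + 2 = m - d := by omega
  rw [hd_eq, hd_succ, hm_sub]
  simp only [hd_eq] at hcard
  have hbound : ∀ {p : ℕ} {B : Fin p → Finset (Fin m)}, IsRCBC r k B →
      (∀ j, (B j).card = d) → p * (d + 1) ≤ (k - 1) * m.choose d :=
    fun hB hBcard => hB.mul_le_mul_choose (by omega) hd (by omega) hBcard
  refine ⟨hA.mul_le_mul_choose_succ (by omega) hd hcard, hbound hA hcard, ?_⟩
  obtain ⟨B, hB, hBcard⟩ : F k m r ∈ {p | ∃ A : Fin p → Finset (Fin m), IsRCBC r k A ∧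
      ∀ j : Fin p, (A j).card = r + k - 2} := by
    refine Nat.sSup_mem ⟨n, A, hA, by simpa only [hd_eq] using hcard⟩
      ⟨(k - 1) * m.choose d, ?_⟩
    rintro p ⟨B, hB, hBcard⟩
    simp only [hd_eq] at hBcard
    exact (Nat.le_mul_of_pos_right p d.succ_pos).trans (hbound hB hBcard)
  simp only [hd_eq] at hBcard
  have hF : ((F k m r * (d + 1) : ℕ) : ℚ) ≤ (((k - 1) * m.choose d : ℕ) : ℚ) :=
    Nat.cast_le.2 (hbound hB hBcard)
  rw [Nat.cast_mul, Nat.cast_mul, Nat.cast_sub (by omega : 1 ≤ k)] at hF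
  push_cast at hF
  have hden : (r : ℚ) + k - 1 = d + 1 := by
    have : (d : ℚ) + 2 = r + k := by exact_mod_cast hd
    linarith
  rw [hden, div_mul_eq_mul_div, le_div_iff₀ (by positivity)]
  exact hF
end
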